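/- arXiv:2109.13106 — 2 statements merged into one kernel-verified Lean document; each statement's English description precedes it below -/
import Mathlib

section
/- Let n ≥ 1. Let g : S^n → S^n be a continuous map on the unit sphere S^n ⊂ ℝ^{n+1} that is odd, i.e., g(−x) = −g(x) for all x ∈ S^n. Then g is not homotopic to any constant map S^n → S^n. -/
namespace Tucker

/-- Mod 2 chains on ordered simplices, in the augmented complex (the empty list has degree `-1`). -/
abbrev Chain (E : Type*) := List E →₀ ZMod 2

noncomputable section

section Chains

variable {E F : Type*}

theorem Chain.add_self (c : Chain E) : c + c = 0 := by
  ext l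
  simpa using CharTwo.add_self_eq_zero (c l)

/-- The cone with apex `x` over a chain. -/
def cone (x : E) : Chain E →ₗ[ZMod 2] Chain E :=
  Finsupp.lmapDomain _ _ (List.cons x)

/-- The chain map induced by a map on vertices. -/
def push (f : E → F) : Chain E →ₗ[ZMod 2] Chain F :=
  Finsupp.lmapDomain _ _ (List.map f)

@[simp] theorem cone_single (x : E) (l : List E) (a : ZMod 2) :
    cone x (Finsupp.single l a) = Finsupp.single (x :: l) a := by
  simp [cone]

@[simp] theorem push_single (f : E → F) (l : List E) (a : ZMod 2) :
    push f (Finsupp.single l a) = Finsupp.single (l.map f) a := by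
  simp [push]

theorem push_cone (f : E → F) (x : E) (c : Chain E) :
    push f (cone x c) = cone (f x) (push f c) := by
  induction c using Finsupp.induction_linear with
  | zero => simp
  | add c₁ c₂ h₁ h₂ => simp [h₁, h₂]
  | single l a => simp

/-- The boundary of a simplex. -/
def bdList : List E → Chain E
  | [] => 0
  | x :: l => Finsupp.single l 1 + cone x (bdList l)

/-- The boundary operator. -/
def bd : Chain E →ₗ[ZMod 2] Chain E := Finsupp.linearCombination _ bdList

@[simp] theorem bd_single (l : List E) (a : ZMod 2) :
    bd (Finsupp.single l a) = a • bdList l := by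
  simp [bd]

theorem bd_cone (x : E) (c : Chain E) : bd (cone x c) = c + cone x (bd c) := by
  induction c using Finsupp.induction_linear with
  | zero => simp
  | add c₁ c₂ h₁ h₂ => simp only [map_add, h₁, h₂]; abel
  | single l a => simp [bdList]

theorem bd_bdList (l : List E) : bd (bdList l) = 0 := by
  induction l with
  | nil => simp [bdList]
  | cons x l ih =>
    simp [bdList, bd_cone, ih, Chain.add_self]

theorem push_bdList (f : E → F) (l : List E) : push f (bdList l) = bdList (l.map f) := by
  induction l with
  | nil => simp [bdList]
  | cons x l ih => simp [bdList, push_cone, ih]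

theorem push_bd (f : E → F) (c : Chain E) : push f (bd c) = bd (push f c) := by
  induction c using Finsupp.induction_linear with
  | zero => simp
  | add c₁ c₂ h₁ h₂ => simp [h₁, h₂]
  | single l a => simp [push_bdList]

theorem push_push_of_involutive {f : E → E} (hf : Function.Involutive f) (c : Chain E) :
    push f (push f c) = c := by
  induction c using Finsupp.induction_linear with
  | zero => simp
  | add c₁ c₂ h₁ h₂ => simp [h₁, h₂]
  | single l a => simp [hf.comp_self]

/-- Chains all of whose simplices satisfy `P`. -/
abbrev chainsIn (P : List E → Prop) : Submodule (ZMod 2) (Chain E) :=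
  Finsupp.supported (ZMod 2) (ZMod 2) {l | P l}

theorem single_mem_chainsIn {P : List E → Prop} {l : List E} (h : P l) (a : ZMod 2) :
    Finsupp.single l a ∈ chainsIn P :=
  Finsupp.single_mem_supported _ _ h

theorem map_mem_of_mem_chainsIn {M : Type*} [AddCommMonoid M] [Module (ZMod 2) M]
    {P : List E → Prop} {N : Submodule (ZMod 2) M} (φ : Chain E →ₗ[ZMod 2] M)
    (h : ∀ l, P l → φ (Finsupp.single l 1) ∈ N) {c : Chain E} (hc : c ∈ chainsIn P) :
    φ c ∈ N := by
  have : chainsIn P ≤ N.comap φ := by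
    rw [chainsIn, Finsupp.supported_eq_span_single, Submodule.span_le]
    rintro _ ⟨l, hl, rfl⟩
    exact h l hl
  exact this hc

theorem cone_mem_chainsIn {P Q : List E → Prop} {x : E} (h : ∀ l, P l → Q (x :: l))
    {c : Chain E} (hc : c ∈ chainsIn P) : cone x c ∈ chainsIn Q :=
  map_mem_of_mem_chainsIn _ (fun l hl => by
    rw [cone_single]; exact single_mem_chainsIn (h l hl) 1) hc

theorem push_mem_chainsIn {P : List E → Prop} {Q : List F → Prop} {f : E → F}
    (h : ∀ l, P l → Q (l.map f)) {c : Chain E} (hc : c ∈ chainsIn P) : push f c ∈ chainsIn Q :=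
  map_mem_of_mem_chainsIn _ (fun l hl => by
    rw [push_single]; exact single_mem_chainsIn (h l hl) 1) hc

theorem bdList_mem_chainsIn (l : List E) :
    bdList l ∈ chainsIn fun l' => l'.length + 1 = l.length ∧ l' ⊆ l := by
  induction l with
  | nil => simp [bdList]
  | cons x l ih =>
    refine add_mem (single_mem_chainsIn (by simp) 1) (cone_mem_chainsIn ?_ ih)
    rintro l' ⟨h₁, h₂⟩
    exact ⟨by simp [h₁], List.cons_subset_cons x h₂⟩

end Chains

section Alternating

/-- The label opposite to `m`: labels come in pairs `2j`, `2j + 1`. -/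
def opp (m : ℕ) : ℕ := if m.bodd then m - 1 else m + 1

theorem bodd_opp (m : ℕ) : (opp m).bodd = !m.bodd := by
  unfold opp
  cases h : m.bodd
  · simp [h]
  · obtain _ | m := m
    · simp at h
    · simpa using h

theorem opp_div_two (m : ℕ) : opp m / 2 = m / 2 := by
  have h := Nat.mod_two_of_bodd m
  unfold opp
  cases hm : m.bodd <;> simp [hm] at h ⊢ <;> omega

theorem eq_or_eq_opp_of_div_two_eq {a b : ℕ} (h : a / 2 = b / 2) : a = b ∨ a = opp b := by
  have h₂ := Nat.mod_two_of_bodd b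
  unfold opp
  cases hm : b.bodd <;> simp [hm] at h₂ ⊢ <;> omega

/-- Indicator of lists of alternating parity, the first entry having parity `p`. -/
def alt : Bool → List ℕ → ZMod 2
  | _, [] => 1
  | p, m :: l => if m.bodd = p then alt (!p) l else 0

/-- The sum of the values of a cochain over the faces of a simplex. -/
def faceSum {α : Type*} : (List α → ZMod 2) → List α → ZMod 2
  | _, [] => 0
  | f, x :: l => f l + faceSum (fun l' => f (x :: l')) l

theorem faceSum_alt (p : Bool) (l : List ℕ) : faceSum (alt p) l = alt p l + alt (!p) l := by
  induction l generalizing p with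
  | nil => simp [faceSum, alt, CharTwo.add_self_eq_zero]
  | cons m l ih =>
    have zero_sum : ∀ l : List ℕ, faceSum (fun _ => 0) l = 0 := fun l => by
      induction l with
      | nil => rfl
      | cons x l ih => simp [faceSum, ih]
    by_cases h : m.bodd = p
    · have h' : ¬ m.bodd = !p := by simp [h]
      simp only [faceSum, alt, h, if_true, ih]
      have := CharTwo.add_self_eq_zero (alt p l)
      simp only [Bool.not_not, Bool.eq_not_self, if_false]
      linear_combination this
    · have h' : m.bodd = !p := by cases hm : m.bodd <;> cases p <;> simp_all
      simp [faceSum, alt, h', zero_sum]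

theorem faceSum_perm {α : Type*} {f : List α → ZMod 2}
    (hf : ∀ l₁ l₂ : List α, l₁.Perm l₂ → f l₁ = f l₂) {l₁ l₂ : List α} (h : l₁.Perm l₂) :
    faceSum f l₁ = faceSum f l₂ := by
  induction h generalizing f with
  | nil => rfl
  | cons x h ih =>
    simp only [faceSum]
    rw [hf _ _ h, ih fun _ _ h' => hf _ _ (h'.cons x)]
  | swap x y l =>
    simp only [faceSum]
    have : (fun l' => f (y :: x :: l')) = fun l' => f (x :: y :: l') :=
      funext fun l' => hf _ _ (List.Perm.swap _ _ _)
    rw [this]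
    ring
  | trans h₁ h₂ ih₁ ih₂ => exact (ih₁ hf).trans (ih₂ hf)

/-- Indicator of lists which alternate in parity once sorted. -/
def sortedAlt (p : Bool) (l : List ℕ) : ZMod 2 := alt p (l.insertionSort (· ≤ ·))

theorem sortedAlt_perm (p : Bool) {l₁ l₂ : List ℕ} (h : l₁.Perm l₂) :
    sortedAlt p l₁ = sortedAlt p l₂ := by
  unfold sortedAlt
  congr 1
  exact (((List.perm_insertionSort _ l₁).trans h).trans
    (List.perm_insertionSort _ l₂).symm).eq_of_pairwise'
      (List.pairwise_insertionSort _ _) (List.pairwise_insertionSort _ _)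

theorem faceSum_congr {α : Type*} {f g : List α → ZMod 2} {l : List α}
    (h : ∀ l', l'.Sublist l → f l' = g l') : faceSum f l = faceSum g l := by
  induction l generalizing f g with
  | nil => rfl
  | cons x l ih =>
    simp only [faceSum]
    rw [h l (List.sublist_cons_self x l), ih fun l' hl' => h _ (hl'.cons_cons x)]

theorem faceSum_sortedAlt (p : Bool) (l : List ℕ) :
    faceSum (sortedAlt p) l = sortedAlt p l + sortedAlt (!p) l := by
  rw [faceSum_perm (fun _ _ => sortedAlt_perm p) (List.perm_insertionSort (· ≤ ·) l).symm,
    sortedAlt, sortedAlt, ← faceSum_alt]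
  refine faceSum_congr fun l' hl' => ?_
  rw [sortedAlt, List.Pairwise.insertionSort_eq]
  exact (List.pairwise_insertionSort _ l).sublist hl'

theorem alt_map_opp (p : Bool) (l : List ℕ) : alt p (l.map opp) = alt (!p) l := by
  induction l generalizing p with
  | nil => rfl
  | cons m l ih =>
    simp only [List.map_cons, alt, bodd_opp, ih]
    congr 1
    cases m.bodd <;> cases p <;> simp

/-- No two entries are opposite labels. -/
def NoOpp (l : List ℕ) : Prop := ∀ a ∈ l, ∀ b ∈ l, a ≠ opp b

theorem NoOpp.div_two_lt {l : List ℕ} (hl : NoOpp l) {a b : ℕ} (ha : a ∈ l) (hb : b ∈ l)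
    (hab : a < b) : a / 2 < b / 2 := by
  refine lt_of_le_of_ne (by omega) fun h => ?_
  rcases eq_or_eq_opp_of_div_two_eq h with h | h
  · omega
  · exact hl a ha b hb h

theorem sortedAlt_map_opp (p : Bool) {l : List ℕ} (hl : NoOpp l) :
    sortedAlt p (l.map opp) = sortedAlt (!p) l := by
  rw [sortedAlt_perm p ((List.perm_insertionSort (· ≤ ·) l).symm.map opp), sortedAlt,
    List.Pairwise.insertionSort_eq, alt_map_opp, sortedAlt]
  rw [List.pairwise_map]
  refine (List.pairwise_insertionSort (· ≤ ·) l).imp_of_mem fun {a b} ha hb hab => ?_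
  rw [List.mem_insertionSort] at ha hb
  rcases hab.eq_or_lt with rfl | hab
  · exact le_rfl
  · have := hl.div_two_lt ha hb hab
    have := opp_div_two a
    have := opp_div_two b
    omega

theorem isChain_of_alt_ne_zero {p : Bool} {l : List ℕ} (h : alt p l ≠ 0) :
    l.IsChain (· ≠ ·) := by
  induction l generalizing p with
  | nil => simp
  | cons a l ih =>
    have h₁ : a.bodd = p := by
      by_contra h'
      simp [alt, h'] at h
    simp only [alt, h₁, if_true] at h
    have h₂ := ih h
    obtain _ | ⟨b, l⟩ := l
    · simp
    · refine List.isChain_cons_cons.2 ⟨?_, h₂⟩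
      rintro rfl
      simp [alt, h₁] at h

theorem sortedAlt_eq_zero (p : Bool) {l : List ℕ} (hl : NoOpp l) {d : ℕ}
    (hd : ∀ a ∈ l, a < 2 * d) (hlen : d < l.length) : sortedAlt p l = 0 := by
  by_contra h
  have h₁ : (l.insertionSort (· ≤ ·)).IsChain (· ≠ ·) := isChain_of_alt_ne_zero h
  have h₂ : (l.insertionSort (· ≤ ·)).IsChain (· ≤ ·) :=
    (List.pairwise_insertionSort (· ≤ ·) l).isChain
  have h₃ : (l.insertionSort (· ≤ ·)).IsChain (· < ·) := by
    rw [List.isChain_iff_getElem] at *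
    exact fun i hi => lt_of_le_of_ne (h₂ i hi) (h₁ i hi)
  have h₄ : (l.insertionSort (· ≤ ·)).Pairwise (· < ·) := h₃.pairwise
  have h₅ : ((l.insertionSort (· ≤ ·)).map (· / 2)).Nodup := by
    rw [List.nodup_iff_pairwise_ne, List.pairwise_map]
    refine h₄.imp_of_mem fun {a b} ha hb hab => ?_
    rw [List.mem_insertionSort] at ha hb
    exact (hl.div_two_lt ha hb hab).ne
  have h₆ : ((l.insertionSort (· ≤ ·)).map (· / 2)) ⊆ List.range d := by
    intro x hx
    obtain ⟨a, ha, rfl⟩ := List.mem_map.1 hx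
    rw [List.mem_insertionSort] at ha
    have := hd a ha
    exact List.mem_range.2 (by omega)
  have := (h₅.subperm h₆).length_le
  simp at this
  omega

variable {E : Type*}

/-- The number mod 2 of alternating simplices of a chain, for a given labelling. -/
def altCount (lab : E → ℕ) (p : Bool) : Chain E →ₗ[ZMod 2] ZMod 2 :=
  Finsupp.linearCombination _ fun l => sortedAlt p (l.map lab)

theorem altCount_single (lab : E → ℕ) (p : Bool) (l : List E) (a : ZMod 2) :
    altCount lab p (Finsupp.single l a) = a * sortedAlt p (l.map lab) := by
  simp [altCount]

theorem map_bdList (φ : Chain E →ₗ[ZMod 2] ZMod 2) (l : List E) :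
    φ (bdList l) = faceSum (fun l' => φ (Finsupp.single l' 1)) l := by
  induction l generalizing φ with
  | nil => simp [bdList, faceSum]
  | cons x l ih =>
    have := ih (φ ∘ₗ cone x)
    simp only [LinearMap.comp_apply, cone_single] at this
    simp [bdList, faceSum, this]

theorem faceSum_map {F : Type*} (f : List F → ZMod 2) (g : E → F) (l : List E) :
    faceSum (fun l' => f (l'.map g)) l = faceSum f (l.map g) := by
  induction l generalizing f with
  | nil => rfl
  | cons x l ih => simp [faceSum, ← ih]

theorem altCount_bd (lab : E → ℕ) (p : Bool) (c : Chain E) :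
    altCount lab p (bd c) = altCount lab p c + altCount lab (!p) c := by
  induction c using Finsupp.induction_linear with
  | zero => simp
  | add c₁ c₂ h₁ h₂ => simp only [map_add, h₁, h₂]; ring
  | single l a =>
    simp only [bd_single, map_smul, map_bdList, altCount_single, one_mul, smul_eq_mul]
    rw [faceSum_map (sortedAlt p) lab, faceSum_sortedAlt]
    ring

theorem altCount_push {lab : E → ℕ} {f : E → E} (p : Bool) {c : Chain E}
    (hc : c ∈ chainsIn fun l => NoOpp (l.map lab) ∧ ∀ x ∈ l, lab (f x) = opp (lab x)) :
    altCount lab p (push f c) = altCount lab (!p) c := by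
  have : (altCount lab p ∘ₗ push f - altCount lab (!p)) c ∈ (⊥ : Submodule (ZMod 2) (ZMod 2)) := by
    refine map_mem_of_mem_chainsIn _ ?_ hc
    rintro l ⟨h₁, h₂⟩
    have : (l.map f).map lab = (l.map lab).map opp := by
      simpa using h₂
    simp [altCount_single, this, sortedAlt_map_opp p h₁, -List.map_map]
  simpa [sub_eq_zero] using this

theorem altCount_eq_zero {lab : E → ℕ} {d : ℕ} (p : Bool) {c : Chain E}
    (hc : c ∈ chainsIn fun l => NoOpp (l.map lab) ∧ (∀ x ∈ l, lab x < 2 * d) ∧ d < l.length) :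
    altCount lab p c = 0 := by
  have : altCount lab p c ∈ (⊥ : Submodule (ZMod 2) (ZMod 2)) := by
    refine map_mem_of_mem_chainsIn _ ?_ hc
    rintro l ⟨h₁, h₂, h₃⟩
    simp [altCount_single, sortedAlt_eq_zero p h₁ (d := d) (by simpa using h₂) (by simpa using h₃)]
  simpa using this

/-- A sequence of chains, each bounding the previous one plus its mirror image, as in the
decomposition of a ball into hemispheres, has no labelling with the properties required in
Tucker's lemma. -/
theorem not_exists_labelling {f : E → E} {d : ℕ} {C : ℕ → Chain E}
    (h₀ : bd (C 0) = Finsupp.single [] 1)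
    (hC : ∀ k, bd (C (k + 1)) = C k + push f (C k)) {lab : E → ℕ}
    (hlt : ∀ k < d, C k ∈ chainsIn fun l =>
      NoOpp (l.map lab) ∧ ∀ x ∈ l, lab (f x) = opp (lab x))
    (hd : C d ∈ chainsIn fun l =>
      NoOpp (l.map lab) ∧ (∀ x ∈ l, lab x < 2 * d) ∧ d < l.length) : False := by
  have key : ∀ k ≤ d, altCount lab false (C k) + altCount lab true (C k) = 1 := by
    intro k
    induction k with
    | zero =>
      intro _
      have := altCount_bd lab false (C 0)
      rw [h₀, altCount_single] at this
      simpa [sortedAlt, alt] using this.symm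
    | succ k ih =>
      intro hk
      have := altCount_bd lab false (C (k + 1))
      rw [hC, map_add, altCount_push false (hlt k hk)] at this
      rw [← ih (by omega)]
      exact this.symm
  have := key d le_rfl
  rw [altCount_eq_zero _ hd, altCount_eq_zero _ hd] at this
  simp at this

end Alternating

section Subdivision

variable {E : Type*} [NormedAddCommGroup E] [NormedSpace ℝ E]

/-- The barycentre of a list of points. -/
def barycentre (l : List E) : E := (l.length : ℝ)⁻¹ • l.sum

theorem barycentre_map_neg (l : List E) : barycentre (l.map Neg.neg) = -barycentre l := by
  simp [barycentre, ← List.sum_neg]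

theorem norm_sum_le_length_mul {E : Type*} [SeminormedAddCommGroup E] {D : ℝ} {l : List E}
    (h : ∀ x ∈ l, ‖x‖ ≤ D) :
    ‖l.sum‖ ≤ l.length * D := by
  induction l with
  | nil => simp
  | cons x l ih =>
    simp only [List.mem_cons, forall_eq_or_imp] at h
    calc ‖(x :: l).sum‖ ≤ ‖x‖ + ‖l.sum‖ := by simpa using norm_add_le x l.sum
      _ ≤ D + l.length * D := add_le_add h.1 (ih h.2)
      _ = _ := by push_cast [List.length_cons]; ring

theorem sum_map_sub (l : List E) (x : E) :
    (l.map (· - x)).sum = l.sum - (l.length : ℝ) • x := by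
  induction l with
  | nil => simp
  | cons y l ih => simp [ih, add_smul]; abel

theorem barycentre_sub {l : List E} (hl : l ≠ []) (x : E) :
    barycentre l - x = (l.length : ℝ)⁻¹ • (l.map (· - x)).sum := by
  have : (l.length : ℝ) ≠ 0 := by simpa using hl
  rw [sum_map_sub, smul_sub, inv_smul_smul₀ this, barycentre]

theorem dist_barycentre_le {l : List E} {N : ℕ} (hN : l.length ≤ N) {D : ℝ}
    (hD : ∀ x ∈ l, ∀ y ∈ l, dist x y ≤ D) {x : E} (hx : x ∈ l) :
    dist x (barycentre l) ≤ (1 - (N : ℝ)⁻¹) * D := by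
  classical
  have hl : l ≠ [] := List.ne_nil_of_mem hx
  have hD0 : 0 ≤ D := dist_nonneg.trans (hD x hx x hx)
  have hpos : (0 : ℝ) < l.length := by exact_mod_cast List.length_pos_iff.2 hl
  have hsum : (l.map (· - x)).sum = ((l.erase x).map (· - x)).sum := by
    rw [((List.perm_cons_erase hx).map (· - x)).sum_eq]
    simp
  have hle : ‖((l.erase x).map (· - x)).sum‖ ≤ (l.length - 1) * D := by
    refine (norm_sum_le_length_mul (D := D) ?_).trans_eq ?_
    · intro y hy
      obtain ⟨z, hz, rfl⟩ := List.mem_map.1 hy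
      rw [← dist_eq_norm]
      exact hD z (List.mem_of_mem_erase hz) x hx
    · rw [List.length_map, List.length_erase_of_mem hx, Nat.cast_pred (List.length_pos_iff.2 hl)]
  rw [dist_comm, dist_eq_norm, barycentre_sub hl, hsum, norm_smul, norm_inv, Real.norm_natCast]
  calc (l.length : ℝ)⁻¹ * ‖((l.erase x).map (· - x)).sum‖
      ≤ (l.length : ℝ)⁻¹ * ((l.length - 1) * D) := by gcongr
    _ = (1 - (l.length : ℝ)⁻¹) * D := by field_simp
    _ ≤ (1 - (N : ℝ)⁻¹) * D := by gcongr

theorem barycentre_mem {K : Set E} (hK : Convex ℝ K) {l : List E} (hl : l ≠ [])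
    (h : ∀ x ∈ l, x ∈ K) : barycentre l ∈ K := by
  have hpos : (l.length : ℝ) ≠ 0 := by simpa using hl
  have : barycentre l = ∑ i : Fin l.length, (l.length : ℝ)⁻¹ • l.get i := by
    rw [← Finset.smul_sum, barycentre]
    congr 1
    rw [← List.sum_ofFn, List.ofFn_get]
  rw [this]
  exact hK.sum_mem (fun _ _ => by positivity) (by simp [hpos]) fun i _ => h _ (l.get_mem i)

/-- Barycentric subdivision of chains of simplices with `k` vertices. -/
def sd : ℕ → Chain E →ₗ[ZMod 2] Chain E
  | 0 => LinearMap.id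
  | k + 1 => Finsupp.linearCombination _ fun l => cone (barycentre l) (sd k (bdList l))

@[simp] theorem sd_succ_single (k : ℕ) (l : List E) (a : ZMod 2) :
    sd (k + 1) (Finsupp.single l a) = a • cone (barycentre l) (sd k (bdList l)) := by
  simp [sd]

theorem bd_sd_succ (k : ℕ) (c : Chain E) : bd (sd (k + 1) c) = sd k (bd c) := by
  induction k generalizing c with
  | zero =>
    induction c using Finsupp.induction_linear with
    | zero => simp
    | add c₁ c₂ h₁ h₂ => simp only [map_add, h₁, h₂]
    | single l a => simp [bd_cone, sd, bd_bdList]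
  | succ k ih =>
    induction c using Finsupp.induction_linear with
    | zero => simp
    | add c₁ c₂ h₁ h₂ => simp only [map_add, h₁, h₂]
    | single l a =>
      rw [sd_succ_single, map_smul, bd_cone, ih, bd_bdList, bd_single, map_smul]
      simp

theorem sd_push_neg (k : ℕ) (c : Chain E) : sd k (push Neg.neg c) = push Neg.neg (sd k c) := by
  induction k generalizing c with
  | zero => rfl
  | succ k ih =>
    induction c using Finsupp.induction_linear with
    | zero => simp
    | add c₁ c₂ h₁ h₂ => simp only [map_add, h₁, h₂]
    | single l a =>
      rw [push_single, sd_succ_single, sd_succ_single, map_smul, push_cone, ← ih, push_bdList,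
        barycentre_map_neg]

theorem sd_single_mem {N k : ℕ} (hk : k ≤ N) {D : ℝ} {l : List E} (hl : l.length = k)
    (hD : ∀ x ∈ l, ∀ y ∈ l, dist x y ≤ D) :
    sd k (Finsupp.single l 1) ∈ chainsIn fun l' => l'.length = k ∧
      (∀ K : Set E, Convex ℝ K → (∀ x ∈ l, x ∈ K) → ∀ x ∈ l', x ∈ K) ∧
      ∀ x ∈ l', ∀ y ∈ l', dist x y ≤ (1 - (N : ℝ)⁻¹) * D := by
  induction k generalizing l with
  | zero =>
    obtain rfl := List.length_eq_zero_iff.1 hl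
    exact single_mem_chainsIn (by simp) 1
  | succ k ih =>
    rw [sd_succ_single, one_smul]
    have hne : l ≠ [] := by rintro rfl; simp at hl
    refine cone_mem_chainsIn (P := fun l' => l'.length = k ∧
      (∀ K : Set E, Convex ℝ K → (∀ x ∈ l, x ∈ K) → ∀ x ∈ l', x ∈ K) ∧
      ∀ x ∈ l', ∀ y ∈ l', dist x y ≤ (1 - (N : ℝ)⁻¹) * D) ?_ ?_
    · rintro l' ⟨h₁, h₂, h₃⟩
      have hb : ∀ x ∈ l', dist x (barycentre l) ≤ (1 - (N : ℝ)⁻¹) * D :=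
        h₂ _ (convex_closedBall _ _) fun x hx => dist_barycentre_le (hl.trans_le hk) hD hx
      have h0 : 0 ≤ (1 - (N : ℝ)⁻¹) * D := by
        obtain ⟨x, hx⟩ := List.exists_mem_of_ne_nil l hne
        exact dist_nonneg.trans (dist_barycentre_le (hl.trans_le hk) hD hx)
      refine ⟨by simp [h₁], fun K hK hKl => ?_, ?_⟩
      · simp only [List.mem_cons, forall_eq_or_imp]
        exact ⟨barycentre_mem hK hne hKl, h₂ K hK hKl⟩
      · simp only [List.mem_cons, forall_eq_or_imp]
        refine ⟨⟨by simpa using h0, fun y hy => ?_⟩, fun y hy => ⟨hb y hy, h₃ y hy⟩⟩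
        rw [dist_comm]
        exact hb y hy
    · refine map_mem_of_mem_chainsIn _ ?_ (bdList_mem_chainsIn l)
      rintro l' ⟨h₁, h₂⟩
      refine Finsupp.supported_mono ?_ (ih (l := l') (by omega) (by omega)
        fun x hx y hy => hD x (h₂ hx) y (h₂ hy))
      rintro l'' ⟨h₃, h₄, h₅⟩
      exact ⟨h₃, fun K hK h => h₄ K hK fun x hx => h x (h₂ hx), h₅⟩

theorem bd_iterate_sd_succ (k m : ℕ) (c : Chain E) :
    bd ((sd (k + 1))^[m] c) = (sd k)^[m] (bd c) :=
  Function.Semiconj.iterate_right (f := bd) (fun c => bd_sd_succ k c) m c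

theorem iterate_sd_push_neg (k m : ℕ) (c : Chain E) :
    (sd k)^[m] (push Neg.neg c) = push Neg.neg ((sd k)^[m] c) :=
  (Function.Semiconj.iterate_right (f := push Neg.neg)
    (fun c => (sd_push_neg k c).symm) m c).symm

/-- The simplices of a subdivided chain become small, and remain within the convex sets that
contained the original ones. -/
theorem iterate_sd_mem {N k : ℕ} (hk : k ≤ N) {D : ℝ} (Q : Set (Set E))
    (hQ : ∀ K ∈ Q, Convex ℝ K) (m : ℕ) {c : Chain E}
    (hc : c ∈ chainsIn fun l => l.length = k ∧ (∃ K ∈ Q, ∀ x ∈ l, x ∈ K) ∧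
      ∀ x ∈ l, ∀ y ∈ l, dist x y ≤ D) :
    (sd k)^[m] c ∈ chainsIn fun l => l.length = k ∧ (∃ K ∈ Q, ∀ x ∈ l, x ∈ K) ∧
      ∀ x ∈ l, ∀ y ∈ l, dist x y ≤ (1 - (N : ℝ)⁻¹) ^ m * D := by
  induction m with
  | zero => simpa using hc
  | succ m ih =>
    rw [Function.iterate_succ_apply']
    refine map_mem_of_mem_chainsIn _ ?_ ih
    rintro l ⟨h₁, ⟨K, hK, h₂⟩, h₃⟩
    refine Finsupp.supported_mono ?_ (sd_single_mem hk h₁ h₃)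
    rintro l' ⟨h₄, h₅, h₆⟩
    exact ⟨h₄, ⟨K, hK, h₅ K (hQ K hK) h₂⟩, fun x hx y hy =>
      (h₆ x hx y hy).trans_eq (by ring)⟩

end Subdivision

section CrossPolytope

variable {d : ℕ}

/-- The standard basis vectors, followed by the origin. -/
def apex (d k : ℕ) : EuclideanSpace ℝ (Fin d) :=
  if h : k < d then EuclideanSpace.single ⟨k, h⟩ 1 else 0

theorem norm_apex_le (d k : ℕ) : ‖apex d k‖ ≤ 1 := by
  unfold apex
  split <;> simp

theorem apex_apply {k : ℕ} (h : k < d) (i : Fin d) :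
    apex d k i = if i = ⟨k, h⟩ then 1 else 0 := by
  simp [apex, h]

/-- The hemispheres of the cross-polytope, and the solid cross-polytope for `k = d`. -/
def hemisphere (d : ℕ) : ℕ → Chain (EuclideanSpace ℝ (Fin d))
  | 0 => Finsupp.single [apex d 0] 1
  | k + 1 => cone (apex d (k + 1)) (hemisphere d k + push Neg.neg (hemisphere d k))

theorem bd_hemisphere_zero : bd (hemisphere d 0) = Finsupp.single [] 1 := by
  simp [hemisphere, bdList]

theorem bd_hemisphere_succ (k : ℕ) :
    bd (hemisphere d (k + 1)) = hemisphere d k + push Neg.neg (hemisphere d k) := by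
  have : bd (hemisphere d k + push Neg.neg (hemisphere d k)) = 0 := by
    induction k with
    | zero => rw [map_add, ← push_bd, bd_hemisphere_zero]; simp [Chain.add_self]
    | succ k ih =>
      rw [map_add, ← push_bd, hemisphere, bd_cone, ih, map_zero, add_zero, map_add,
        push_push_of_involutive neg_involutive, add_comm (push _ _), Chain.add_self]
  rw [hemisphere, bd_cone, this, map_zero, add_zero]

theorem hemisphere_mem (k : ℕ) :
    hemisphere d k ∈ chainsIn fun l => l.length = k + 1 ∧ (∀ x ∈ l, ‖x‖ ≤ 1) ∧
      (k < d → ∃ ε : Fin d → ℝ, (∀ i, |ε i| ≤ 1) ∧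
        ∀ x ∈ l, 1 ≤ ∑ i, ε i * x i ∧ ∀ i : Fin d, k < i → x i = 0) := by
  induction k with
  | zero =>
    refine single_mem_chainsIn ⟨rfl, by simp [norm_apex_le], fun h => ⟨1, by simp, ?_⟩⟩ 1
    simp only [List.mem_singleton, forall_eq, apex_apply h]
    refine ⟨by simp, fun i hi => if_neg ?_⟩
    rintro rfl
    simp at hi
  | succ k ih =>
    refine cone_mem_chainsIn ?_ (add_mem ih (push_mem_chainsIn ?_ ih))
    · rintro l ⟨h₁, h₂, h₃⟩
      refine ⟨by simp [h₁], by simpa [norm_apex_le] using h₂, fun h => ?_⟩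
      obtain ⟨ε, hε, hl⟩ := h₃ (by omega)
      refine ⟨Function.update ε ⟨k + 1, h⟩ 1, fun i => ?_, ?_⟩
      · by_cases hi : i = ⟨k + 1, h⟩
        · simp [hi]
        · simpa [Function.update_of_ne hi] using hε i
      · simp only [List.mem_cons, forall_eq_or_imp, apex_apply h]
        refine ⟨⟨by simp, fun i hi => if_neg ?_⟩, fun x hx => ⟨?_, fun i hi => ?_⟩⟩
        · rintro rfl
          simp at hi
        · refine (hl x hx).1.trans_eq (Finset.sum_congr rfl fun i _ => ?_)
          by_cases hi : i = ⟨k + 1, h⟩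
          · have := (hl x hx).2 i (by simp [hi])
            simp [this]
          · simp [Function.update_of_ne hi]
        · exact (hl x hx).2 i (by omega)
    · rintro l ⟨h₁, h₂, h₃⟩
      refine ⟨by simp [h₁], List.forall_mem_map.2 fun x hx => by simpa using h₂ x hx,
        fun h => ?_⟩
      obtain ⟨ε, hε, hl⟩ := h₃ h
      exact ⟨-ε, by simpa using hε, List.forall_mem_map.2 fun x hx => by simpa using hl x hx⟩

theorem convex_one_le_sum (ε : Fin d → ℝ) :
    Convex ℝ {x : EuclideanSpace ℝ (Fin d) | 1 ≤ ∑ i, ε i * x i} := by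
  refine convex_halfSpace_ge (f := fun x : EuclideanSpace ℝ (Fin d) => ∑ i, ε i * x i)
    ⟨fun x y => ?_, fun c x => ?_⟩ 1
  · simp [mul_add, Finset.sum_add_distrib]
  · simp [Finset.mul_sum, mul_left_comm]

/-- A form of Tucker's lemma for labellings of the points of a ball which are odd outside the
open cross-polytope. -/
theorem tucker {lab : EuclideanSpace ℝ (Fin d) → ℕ} (hlt : ∀ x, lab x < 2 * d)
    (hodd : ∀ x, 1 ≤ ∑ i, |x i| → lab (-x) = opp (lab x)) {δ : ℝ} (hδ : 0 < δ) :
    ∃ x y, ‖x‖ ≤ 1 ∧ ‖y‖ ≤ 1 ∧ dist x y < δ ∧ lab x = opp (lab y) := by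
  by_contra! hno
  obtain ⟨m, hm⟩ : ∃ m : ℕ, (1 - ((d + 1 : ℕ) : ℝ)⁻¹) ^ m * 2 < δ := by
    obtain ⟨m, hm⟩ := exists_pow_lt_of_lt_one (half_pos hδ)
      (show 1 - ((d + 1 : ℕ) : ℝ)⁻¹ < 1 by
        have : (0 : ℝ) < ((d + 1 : ℕ) : ℝ)⁻¹ := by positivity
        linarith)
    exact ⟨m, by linarith⟩
  have noOpp : ∀ l : List (EuclideanSpace ℝ (Fin d)), (∀ x ∈ l, ‖x‖ ≤ 1) →
      (∀ x ∈ l, ∀ y ∈ l, dist x y ≤ (1 - ((d + 1 : ℕ) : ℝ)⁻¹) ^ m * 2) →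
      NoOpp (l.map lab) := by
    intro l h₁ h₂ a ha b hb
    obtain ⟨x, hx, rfl⟩ := List.mem_map.1 ha
    obtain ⟨y, hy, rfl⟩ := List.mem_map.1 hb
    exact hno x y (h₁ x hx) (h₁ y hy) ((h₂ x hx y hy).trans_lt hm)
  have dist_le : ∀ l : List (EuclideanSpace ℝ (Fin d)), (∀ x ∈ l, ‖x‖ ≤ 1) →
      ∀ x ∈ l, ∀ y ∈ l, dist x y ≤ 2 := by
    intro l h x hx y hy
    have := dist_le_norm_add_norm x y
    linarith [h x hx, h y hy]
  have ball_convex := convex_closedBall (0 : EuclideanSpace ℝ (Fin d)) 1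
  refine not_exists_labelling (f := Neg.neg) (d := d) (lab := lab)
    (C := fun k => (sd (k + 1))^[m] (hemisphere d k)) ?_ (fun k => ?_) (fun k hk => ?_) ?_
  · rw [bd_iterate_sd_succ, bd_hemisphere_zero]
    exact Function.iterate_fixed rfl m
  · rw [bd_iterate_sd_succ, bd_hemisphere_succ, ← iterate_sd_push_neg, ← Module.End.coe_pow,
      ← map_add]
  · let Q : Set (Set (EuclideanSpace ℝ (Fin d))) :=
      {K | ∃ ε : Fin d → ℝ, (∀ i, |ε i| ≤ 1) ∧
        K = Metric.closedBall 0 1 ∩ {x | 1 ≤ ∑ i, ε i * x i}}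
    refine Finsupp.supported_mono ?_ (iterate_sd_mem (N := d + 1) (D := 2) (by omega) Q ?_ m
      (Finsupp.supported_mono ?_ (hemisphere_mem k)))
    · rintro l ⟨-, ⟨_, ⟨ε, hε, rfl⟩, hl⟩, hdist⟩
      refine ⟨noOpp l (fun x hx => by simpa using (hl x hx).1) hdist,
        fun x hx => hodd x ((hl x hx).2.trans (Finset.sum_le_sum fun i _ => ?_))⟩
      calc ε i * x i ≤ |ε i| * |x i| := (le_abs_self _).trans_eq (abs_mul _ _)
        _ ≤ |x i| := mul_le_of_le_one_left (abs_nonneg _) (hε i)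
    · rintro _ ⟨ε, -, rfl⟩
      exact ball_convex.inter (convex_one_le_sum ε)
    · rintro l ⟨h₁, h₂, h₃⟩
      obtain ⟨ε, hε, hl⟩ := h₃ hk
      exact ⟨h₁, ⟨_, ⟨ε, hε, rfl⟩, fun x hx => ⟨by simpa using h₂ x hx, (hl x hx).1⟩⟩,
        dist_le l h₂⟩
  · refine Finsupp.supported_mono ?_ (iterate_sd_mem (N := d + 1) (D := 2) le_rfl
      {Metric.closedBall 0 1} (by simpa using ball_convex) m
      (Finsupp.supported_mono ?_ (hemisphere_mem d)))
    · rintro l ⟨h₁, ⟨_, rfl, hl⟩, hdist⟩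
      refine ⟨noOpp l (fun x hx => by simpa using hl x hx) hdist, fun x _ => hlt x, by omega⟩
    · rintro l ⟨h₁, h₂, -⟩
      exact ⟨h₁, ⟨_, rfl, fun x hx => by simpa using h₂ x hx⟩, dist_le l h₂⟩

end CrossPolytope

section SphereLabels

variable {d : ℕ}

theorem exists_one_le_mul_sq (u : Metric.sphere (0 : EuclideanSpace ℝ (Fin d)) 1) :
    ∃ i : Fin d, 1 ≤ d * (u.1 i) ^ 2 := by
  by_contra! h
  have h₁ : ∑ i, (u.1 i) ^ 2 = 1 := by
    rw [← EuclideanSpace.real_norm_sq_eq, norm_eq_of_mem_sphere u, one_pow]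
  have hd : Nonempty (Fin d) := by
    by_contra hd
    rw [not_nonempty_iff] at hd
    simp at h₁
  have : ∑ i : Fin d, d * (u.1 i) ^ 2 < ∑ _i : Fin d, (1 : ℝ) :=
    Finset.sum_lt_sum_of_nonempty Finset.univ_nonempty fun i _ => h i
  simp [← Finset.mul_sum, h₁] at this

open Classical in
/-- The label of a point `u` of the sphere: a coordinate of `u` which is not small, together with
its sign. -/
def sphereLabel (u : Metric.sphere (0 : EuclideanSpace ℝ (Fin d)) 1) : ℕ :=
  2 * (exists_one_le_mul_sq u).choose + if 0 < u.1 (exists_one_le_mul_sq u).choose then 0 else 1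

theorem sphereLabel_lt (u : Metric.sphere (0 : EuclideanSpace ℝ (Fin d)) 1) :
    sphereLabel u < 2 * d := by
  unfold sphereLabel
  split <;> omega

theorem opp_two_mul (j : ℕ) : opp (2 * j) = 2 * j + 1 := by
  simp [opp]

theorem opp_two_mul_add_one (j : ℕ) : opp (2 * j + 1) = 2 * j := by
  simp [opp]

theorem sphereLabel_neg (u : Metric.sphere (0 : EuclideanSpace ℝ (Fin d)) 1) :
    sphereLabel (-u) = opp (sphereLabel u) := by
  have key : (exists_one_le_mul_sq (-u)).choose = (exists_one_le_mul_sq u).choose := by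
    congr! 4
    simp
  have hi := (exists_one_le_mul_sq u).choose_spec
  unfold sphereLabel
  rw [key]
  generalize (exists_one_le_mul_sq u).choose = i at hi
  rcases lt_trichotomy (u.1 i) 0 with h | h | h
  · simp [h, not_lt.2 h.le, opp_two_mul_add_one]
  · norm_num [h] at hi
  · simp [h, not_lt.2 h.le, opp_two_mul]

theorem one_le_mul_dist_sq {u v : Metric.sphere (0 : EuclideanSpace ℝ (Fin d)) 1}
    (h : sphereLabel u = opp (sphereLabel v)) : 1 ≤ d * dist u v ^ 2 := by
  rw [← sphereLabel_neg] at h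
  have hu := (exists_one_le_mul_sq u).choose_spec
  unfold sphereLabel at h
  have hij : (exists_one_le_mul_sq u).choose = (exists_one_le_mul_sq (-v)).choose := by
    split_ifs at h <;> omega
  rw [← hij] at h
  generalize (exists_one_le_mul_sq u).choose = i at h hu
  have hsq : (u.1 i) ^ 2 ≤ dist u v ^ 2 := by
    have h₁ : |u.1 i - v.1 i| ≤ dist u v := by
      rw [Subtype.dist_eq, dist_eq_norm]
      simpa using PiLp.norm_apply_le (u.1 - v.1) i
    have h₂ : |u.1 i| ≤ |u.1 i - v.1 i| := by
      split_ifs at h with h₃ h₄ h₄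
      · have : v.1 i < 0 := by simpa using h₄
        rw [abs_of_pos h₃, abs_of_pos (by linarith)]
        linarith
      · omega
      · omega
      · have : 0 ≤ v.1 i := by simpa using h₄
        rw [abs_of_nonpos (by linarith), abs_of_nonpos (by linarith)]
        linarith
    exact sq_le_sq' (by linarith [neg_abs_le (u.1 i)]) ((le_abs_self _).trans (h₂.trans h₁))
  exact hu.trans (by gcongr)

/-- A continuous map to the sphere cannot be odd outside the open cross-polytope. -/
theorem not_odd_outside_crossPolytope {Φ : EuclideanSpace ℝ (Fin d) →
      Metric.sphere (0 : EuclideanSpace ℝ (Fin d)) 1} (hΦ : Continuous Φ)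
    (hodd : ∀ x, 1 ≤ ∑ i, |x i| → Φ (-x) = -Φ x) : False := by
  have hpos : (0 : ℝ) < d + 1 := by positivity
  have huc := (isCompact_closedBall (0 : EuclideanSpace ℝ (Fin d)) 1)
    |>.uniformContinuousOn_of_continuous hΦ.continuousOn
  obtain ⟨δ, hδ, h⟩ := Metric.uniformContinuousOn_iff.1 huc (d + 1 : ℝ)⁻¹ (by positivity)
  obtain ⟨x, y, hx, hy, hxy, hlab⟩ := tucker (lab := sphereLabel ∘ Φ)
    (fun x => sphereLabel_lt _)
    (fun x hx => by simp only [Function.comp_apply, hodd x hx, sphereLabel_neg]) hδ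
  have h₁ := h x (by simpa using hx) y (by simpa using hy) hxy
  have h₂ := one_le_mul_dist_sq hlab
  have h₃ : dist (Φ x) (Φ y) * (d + 1) < 1 := by
    rwa [← lt_inv_mul_iff₀' hpos, mul_one]
  have h₄ : dist (Φ x) (Φ y) ≤ 1 := by nlinarith [dist_nonneg (x := Φ x) (y := Φ y)]
  nlinarith [dist_nonneg (x := Φ x) (y := Φ y)]

end SphereLabels

section Homotopy

variable {d : ℕ}

/-- The radial projection onto the sphere, with the value `y` at the origin. -/
def radial (y : Metric.sphere (0 : EuclideanSpace ℝ (Fin d)) 1) (x : EuclideanSpace ℝ (Fin d)) :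
    Metric.sphere (0 : EuclideanSpace ℝ (Fin d)) 1 :=
  if h : x = 0 then y else ⟨‖x‖⁻¹ • x, by simp [norm_smul, h]⟩

theorem radial_neg (y : Metric.sphere (0 : EuclideanSpace ℝ (Fin d)) 1)
    {x : EuclideanSpace ℝ (Fin d)} (hx : x ≠ 0) : radial y (-x) = -radial y x := by
  ext1
  simp [radial, hx]

theorem continuousAt_radial (y : Metric.sphere (0 : EuclideanSpace ℝ (Fin d)) 1)
    {x : EuclideanSpace ℝ (Fin d)} (hx : x ≠ 0) : ContinuousAt (radial y) x := by
  rw [Topology.IsInducing.subtypeVal.continuousAt_iff]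
  have : ContinuousAt (fun x : EuclideanSpace ℝ (Fin d) => ‖x‖⁻¹ • x) x :=
    (continuousAt_id.norm.inv₀ (by simpa using hx)).smul continuousAt_id
  refine this.congr ?_
  filter_upwards [isOpen_ne.mem_nhds hx] with z hz
  simp [radial, show z ≠ 0 from hz]

theorem not_homotopic_const_of_odd
    (g : C(Metric.sphere (0 : EuclideanSpace ℝ (Fin d)) 1,
      Metric.sphere (0 : EuclideanSpace ℝ (Fin d)) 1))
    (hg : ∀ x, g (-x) = -g x) (y : Metric.sphere (0 : EuclideanSpace ℝ (Fin d)) 1) :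
    ¬ g.Homotopic (ContinuousMap.const _ y) := by
  rintro ⟨H⟩
  have hτ : Continuous fun x : EuclideanSpace ℝ (Fin d) =>
      Set.projIcc (0 : ℝ) 1 zero_le_one (2 - 2 * ∑ i, |x i|) :=
    continuous_projIcc.comp (by fun_prop)
  refine not_odd_outside_crossPolytope (d := d) (Φ := fun x =>
    H (Set.projIcc (0 : ℝ) 1 zero_le_one (2 - 2 * ∑ i, |x i|), radial y x)) ?_ ?_
  · refine continuous_iff_continuousAt.2 fun x => ?_
    by_cases hx : x = 0
    · refine continuousAt_const (y := y) |>.congr ?_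
      have : ∀ᶠ z : EuclideanSpace ℝ (Fin d) in nhds x, ∑ i, |z i| < 1 / 2 :=
        (show Continuous fun z : EuclideanSpace ℝ (Fin d) => ∑ i, |z i| by
          fun_prop).continuousAt.eventually_lt_const (by simp [hx])
      filter_upwards [this] with z hz
      rw [Set.projIcc_of_right_le _ (by linarith)]
      exact (H.apply_one _).symm
    · exact H.continuous.continuousAt.comp (hτ.continuousAt.prodMk (continuousAt_radial y hx))
  · intro x hx
    have hx0 : x ≠ 0 := by
      rintro rfl
      norm_num at hx
    simp only [PiLp.neg_apply, abs_neg]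
    rw [Set.projIcc_of_le_left _ (by linarith), radial_neg y hx0]
    exact (H.apply_zero _).trans ((hg _).trans (congrArg _ (H.apply_zero _).symm))

end Homotopy

end

end Tucker

/-- An odd continuous self-map of the sphere `S^n` is not homotopic to any constant map. -/
theorem odd_not_homotopic_const (n : ℕ) (hn : 1 ≤ n)
    (g : C(Metric.sphere (0 : EuclideanSpace ℝ (Fin (n + 1))) 1,
           Metric.sphere (0 : EuclideanSpace ℝ (Fin (n + 1))) 1))
    (hg : ∀ x, g (-x) = -g x) :
    ∀ y : Metric.sphere (0 : EuclideanSpace ℝ (Fin (n + 1))) 1,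
      ¬ g.Homotopic (ContinuousMap.const _ y) := by
  exact Tucker.not_homotopic_const_of_odd g hg
end

section
/- Let n ≥ 2 be an even integer. Let g : S^n → S^n be a continuous map on the unit sphere S^n ⊂ ℝ^{n+1} that is odd, i.e., g(−x) = −g(x) for all x ∈ S^n. Then g is not homotopic to the map x ↦ −g(x). -/
open Finsupp

/-! ### Chains of vertex lists -/

/-- Integral chains whose simplices are finite lists of points. -/
abbrev ListChain (X : Type*) := List X →₀ ℤ

namespace ListChain

variable {X Y : Type*}

/-- The cone with apex `v`. -/
noncomputable def cone (v : X) : ListChain X →ₗ[ℤ] ListChain X :=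
  lmapDomain ℤ ℤ (List.cons v)

/-- The chain map induced by a map of vertices. -/
noncomputable def push (f : X → Y) : ListChain X →ₗ[ℤ] ListChain Y :=
  lmapDomain ℤ ℤ (List.map f)

/-- The boundary of a single list. -/
noncomputable def bdList : List X → ListChain X
  | [] => 0
  | v :: t => single t 1 - cone v (bdList t)

/-- The (augmented) boundary operator. -/
noncomputable def bd : ListChain X →ₗ[ℤ] ListChain X := linearCombination ℤ bdList

/-- The prism over a single list, with bottom `f` and top `g`. -/
noncomputable def prismList (f g : X → Y) : List X → ListChain Y
  | [] => 0
  | v :: t => single (f v :: g v :: t.map g) 1 - cone (f v) (prismList f g t)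

/-- The prism operator between the chain maps induced by `f` and `g`. -/
noncomputable def prism (f g : X → Y) : ListChain X →ₗ[ℤ] ListChain Y :=
  linearCombination ℤ (prismList f g)

/-- Evaluation of a cochain on chains. -/
noncomputable def eval (φ : List X → ℤ) : ListChain X →ₗ[ℤ] ℤ := linearCombination ℤ φ

@[simp] lemma cone_single (v : X) (l : List X) (a : ℤ) :
    cone v (single l a) = single (v :: l) a := by simp [cone]

@[simp] lemma push_single (f : X → Y) (l : List X) (a : ℤ) :
    push f (single l a) = single (l.map f) a := by simp [push]

@[simp] lemma bd_single (l : List X) : bd (single l 1) = bdList l := by simp [bd]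

@[simp] lemma prism_single (f g : X → Y) (l : List X) :
    prism f g (single l 1) = prismList f g l := by simp [prism]

@[simp] lemma eval_single (φ : List X → ℤ) (l : List X) : eval φ (single l 1) = φ l := by
  simp [eval]

lemma hom_ext {M : Type*} [AddCommGroup M] {S T : ListChain X →ₗ[ℤ] M}
    (h : ∀ l, S (single l 1) = T (single l 1)) : S = T :=
  Finsupp.lhom_ext' fun l => LinearMap.ext_ring (h l)

lemma hom_ext_apply {M : Type*} [AddCommGroup M] (S T : ListChain X →ₗ[ℤ] M)
    (h : ∀ l, S (single l 1) = T (single l 1)) (c : ListChain X) : S c = T c := by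
  rw [hom_ext h]

lemma map_mem_of_supported {M : Type*} [AddCommGroup M] {P : Set (List X)}
    (T : ListChain X →ₗ[ℤ] M) (N : Submodule ℤ M) (h : ∀ l ∈ P, T (single l 1) ∈ N)
    {c : ListChain X} (hc : c ∈ supported ℤ ℤ P) : T c ∈ N := by
  rw [supported_eq_span_single] at hc
  have : Submodule.span ℤ ((fun i => single i (1 : ℤ)) '' P) ≤ N.comap T := by
    rw [Submodule.span_le]
    rintro _ ⟨l, hl, rfl⟩
    exact h l hl
  exact this hc

lemma eq_of_supported {M : Type*} [AddCommGroup M] {P : Set (List X)}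
    (S T : ListChain X →ₗ[ℤ] M) (h : ∀ l ∈ P, S (single l 1) = T (single l 1))
    {c : ListChain X} (hc : c ∈ supported ℤ ℤ P) : S c = T c := by
  have := map_mem_of_supported (S - T) ⊥ (fun l hl => by simp [h l hl]) hc
  simpa [sub_eq_zero] using this

lemma single_mem {P : Set (List X)} {l : List X} (hl : l ∈ P) :
    single l (1 : ℤ) ∈ supported ℤ ℤ P := single_mem_supported ℤ 1 hl

@[simp] lemma bd_cone (v : X) (c : ListChain X) : bd (cone v c) = c - cone v (bd c) :=
  hom_ext_apply (bd ∘ₗ cone v) (LinearMap.id - cone v ∘ₗ bd) (fun l => by simp [bdList]) c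

lemma push_cone (f : X → Y) (v : X) (c : ListChain X) :
    push f (cone v c) = cone (f v) (push f c) :=
  hom_ext_apply (push f ∘ₗ cone v) (cone (f v) ∘ₗ push f) (fun l => by simp) c

lemma prism_cone (f g : X → Y) (v : X) (c : ListChain X) :
    prism f g (cone v c) = cone (f v) (cone (g v) (push g c)) - cone (f v) (prism f g c) :=
  hom_ext_apply (prism f g ∘ₗ cone v)
    (cone (f v) ∘ₗ cone (g v) ∘ₗ push g - cone (f v) ∘ₗ prism f g)
    (fun l => by simp [prismList]) c

lemma bd_push (f : X → Y) (c : ListChain X) : bd (push f c) = push f (bd c) := by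
  refine hom_ext_apply (bd ∘ₗ push f) (push f ∘ₗ bd) (fun l => ?_) c
  induction l with
  | nil => simp [bdList]
  | cons v t ih =>
    simp only [LinearMap.comp_apply, push_single, bd_single] at ih
    simp [bdList, ih, push_cone]

lemma push_push {Z : Type*} (f : X → Y) (g : Y → Z) (c : ListChain X) :
    push g (push f c) = push (g ∘ f) c :=
  hom_ext_apply (push g ∘ₗ push f) (push (g ∘ f)) (fun l => by simp) c

lemma push_id (c : ListChain X) : push (fun x => x) c = c :=
  hom_ext_apply (push fun x => x) LinearMap.id (fun l => by simp) c

lemma bd_prism (f g : X → Y) (c : ListChain X) :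
    bd (prism f g c) + prism f g (bd c) = push g c - push f c := by
  refine hom_ext_apply (bd ∘ₗ prism f g + prism f g ∘ₗ bd) (push g - push f) (fun l => ?_) c
  induction l with
  | nil => simp [bdList, prismList]
  | cons v t ih =>
    simp only [LinearMap.comp_apply, LinearMap.add_apply, LinearMap.sub_apply, push_single,
      bd_single, prism_single] at ih
    have h1 : bd (prismList f g t) = single (t.map g) 1 - single (t.map f) 1
        - prism f g (bdList t) := by rw [← ih]; abel
    have h2 : bdList (t.map g) = push g (bdList t) := by
      simpa using bd_push g (single t 1)
    simp only [bdList, prismList, prism_cone, h1, h2, map_sub, bd_cone, bd_single, cone_single,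
      prism_single, List.map_cons, LinearMap.comp_apply, LinearMap.add_apply, LinearMap.sub_apply,
      push_single]
    abel

/-! ### The cochains detecting the degree -/

/-- The product of the successive differences `S i u - S i v` along a list. -/
def diffProd : (ℕ → X → ℤ) → X → List X → ℤ
  | _, _, [] => 1
  | S, v, u :: t => (S 0 u - S 0 v) * diffProd (fun i => S (i + 1)) u t

/-- The cup product of the coboundaries `δ (S 0), δ (S 1), …`. -/
def cupDiff (S : ℕ → X → ℤ) : List X → ℤ
  | [] => 0
  | v :: t => diffProd S v t

/-- The cup product `S 0 ∪ δ (S 1) ∪ δ (S 2) ∪ …`. -/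
def cupSign (S : ℕ → X → ℤ) : List X → ℤ
  | [] => 1
  | v :: t => S 0 v * diffProd (fun i => S (i + 1)) v t

lemma cupDiff_cone (S : ℕ → X → ℤ) (v : X) (c : ListChain X) :
    eval (cupDiff S) (cone v c) =
      eval (cupSign S) c - S 0 v * eval (cupDiff fun i => S (i + 1)) c := by
  refine hom_ext_apply (eval (cupDiff S) ∘ₗ cone v)
    (eval (cupSign S) - S 0 v • eval (cupDiff fun i => S (i + 1))) (fun l => ?_) c
  cases l with
  | nil => simp [cupDiff, cupSign, diffProd]
  | cons u t => simp [cupDiff, cupSign, diffProd]; ring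

lemma cupSign_cone (S : ℕ → X → ℤ) (v : X) (c : ListChain X) :
    eval (cupSign S) (cone v c) = S 0 v * eval (cupDiff fun i => S (i + 1)) (cone v c) :=
  hom_ext_apply (eval (cupSign S) ∘ₗ cone v)
    (S 0 v • eval (cupDiff fun i => S (i + 1)) ∘ₗ cone v)
    (fun l => by simp [cupDiff, cupSign]) c

lemma eval_bdList (l : List X) : ∀ S : ℕ → X → ℤ,
    eval (cupDiff S) (bdList l) = 0 ∧ eval (cupSign S) (bdList l) = cupDiff S l := by
  induction l with
  | nil => intro S; simp [bdList, cupDiff]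
  | cons v t ih =>
    intro S
    have key := cupDiff_cone S v (single t 1)
    simp only [cone_single, eval_single] at key
    simp only [bdList, map_sub, eval_single, cupSign_cone, cupDiff_cone, (ih _).1, (ih _).2, key]
    constructor <;> ring

/-- The coboundary of `cupSign S` is `cupDiff S`. -/
lemma cupSign_bd (S : ℕ → X → ℤ) (c : ListChain X) :
    eval (cupSign S) (bd c) = eval (cupDiff S) c :=
  hom_ext_apply (eval (cupSign S) ∘ₗ bd) (eval (cupDiff S))
    (fun l => by simp [(eval_bdList l S).2]) c

lemma diffProd_map (S : ℕ → Y → ℤ) (f : X → Y) (v : X) (t : List X) :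
    diffProd S (f v) (t.map f) = diffProd (fun i x => S i (f x)) v t := by
  induction t generalizing v S with
  | nil => rfl
  | cons u t ih => simp [diffProd, ih]

lemma cupSign_push (S : ℕ → Y → ℤ) (f : X → Y) (c : ListChain X) :
    eval (cupSign S) (push f c) = eval (cupSign fun i x => S i (f x)) c := by
  refine hom_ext_apply (eval (cupSign S) ∘ₗ push f) (eval (cupSign fun i x => S i (f x)))
    (fun l => ?_) c
  cases l with
  | nil => simp [cupSign]
  | cons v t => simp [cupSign, diffProd_map]

lemma diffProd_neg [Neg X] (S : ℕ → X → ℤ) (v : X) (t : List X)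
    (h : ∀ i, ∀ u ∈ v :: t, S i (-u) = 1 - S i u) :
    diffProd S (-v) (t.map Neg.neg) = (-1) ^ t.length * diffProd S v t := by
  induction t generalizing v S with
  | nil => simp [diffProd]
  | cons u t ih =>
    have := ih (fun i => S (i + 1)) u fun i w hw => h (i + 1) w (List.mem_cons_of_mem _ hw)
    simp only [List.map_cons, diffProd, this, h 0 v (by simp), h 0 u (by simp),
      List.length_cons, pow_succ]
    ring

lemma cupSign_neg [Neg X] (S : ℕ → X → ℤ) {K : Set X} {m : ℕ}
    (h : ∀ i, ∀ u ∈ K, S i (-u) = 1 - S i u) {c : ListChain X}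
    (hc : c ∈ supported ℤ ℤ {l | l.length = m + 1 ∧ ∀ u ∈ l, u ∈ K}) :
    eval (cupSign S) (push Neg.neg c) =
      (-1) ^ m * (eval (cupDiff fun i => S (i + 1)) c - eval (cupSign S) c) := by
  refine eq_of_supported (eval (cupSign S) ∘ₗ push Neg.neg)
    ((-1 : ℤ) ^ m • (eval (cupDiff fun i => S (i + 1)) - eval (cupSign S))) ?_ hc
  rintro (_ | ⟨v, t⟩) ⟨hl, hK⟩
  · simp at hl
  · obtain rfl : t.length = m := by simpa using hl
    have := diffProd_neg (fun i => S (i + 1)) v t fun i u hu => h (i + 1) u (hK u hu)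
    simp only [LinearMap.comp_apply, push_single, eval_single, List.map_cons, cupSign, this,
      h 0 v (hK v (by simp)), LinearMap.smul_apply, LinearMap.sub_apply, cupDiff, smul_eq_mul]
    ring

lemma diffProd_eq_zero (S : ℕ → X → ℤ) (v : X) (t : List X) (i : ℕ) (hi : i < t.length)
    (a : ℤ) (h : ∀ u ∈ v :: t, S i u = a) : diffProd S v t = 0 := by
  induction t generalizing v S i with
  | nil => simp at hi
  | cons u t ih =>
    cases i with
    | zero => simp [diffProd, h u (by simp), h v (by simp)]
    | succ i =>
      rw [diffProd, ih (fun i => S (i + 1)) u i (by simpa using hi)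
        fun w hw => h w (List.mem_cons_of_mem _ hw), mul_zero]

/-! ### Small chains and homotopies -/

/-- Lists of `m` points of `K` with pairwise distances less than `ε`. -/
def smallLists [PseudoMetricSpace X] (m : ℕ) (ε : ℝ) (K : Set X) : Set (List X) :=
  {l | l.length = m ∧ (∀ v ∈ l, v ∈ K) ∧ ∀ u ∈ l, ∀ v ∈ l, dist u v < ε}

lemma cone_mem {P Q : Set (List X)} (v : X) (h : ∀ l ∈ P, v :: l ∈ Q) {c : ListChain X}
    (hc : c ∈ supported ℤ ℤ P) : cone v c ∈ supported ℤ ℤ Q :=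
  map_mem_of_supported _ _ (fun l hl => by simpa using single_mem (h l hl)) hc

lemma push_mem {P : Set (List X)} {Q : Set (List Y)} (f : X → Y) (h : ∀ l ∈ P, l.map f ∈ Q)
    {c : ListChain X} (hc : c ∈ supported ℤ ℤ P) : push f c ∈ supported ℤ ℤ Q :=
  map_mem_of_supported _ _ (fun l hl => by simpa using single_mem (h l hl)) hc

lemma prismList_mem (f g : X → Y) (l : List X) :
    prismList f g l ∈ supported ℤ ℤ
      {l' | l'.length = l.length + 1 ∧ ∀ y ∈ l', ∃ v ∈ l, y = f v ∨ y = g v} := by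
  induction l with
  | nil => exact zero_mem _
  | cons v t ih =>
    refine sub_mem (single_mem ⟨by simp, ?_⟩) (cone_mem _ ?_ ih)
    · intro y hy
      simp only [List.mem_cons, List.mem_map] at hy
      rcases hy with rfl | rfl | ⟨u, hu, rfl⟩
      · exact ⟨v, by simp, Or.inl rfl⟩
      · exact ⟨v, by simp, Or.inr rfl⟩
      · exact ⟨u, by simp [hu], Or.inr rfl⟩
    · rintro l ⟨hl, h⟩
      refine ⟨by simp [hl], fun y hy => ?_⟩
      rcases List.mem_cons.1 hy with rfl | hy
      · exact ⟨v, by simp, Or.inl rfl⟩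
      · obtain ⟨u, hu, h⟩ := h y hy
        exact ⟨u, by simp [hu], h⟩

/-- A uniformly continuous homotopy carries sufficiently small cycles to homologous cycles. -/
lemma exists_homotopy_chain [PseudoMetricSpace X] [PseudoMetricSpace Y] (F : ℝ → X → Y)
    {K : Set X} {D : Set Y} (hD : ∀ t ∈ Set.Icc (0 : ℝ) 1, ∀ x ∈ K, F t x ∈ D)
    (hF : ∀ ε > 0, ∃ δ > 0, ∀ t ∈ Set.Icc (0 : ℝ) 1, ∀ t' ∈ Set.Icc (0 : ℝ) 1, ∀ x ∈ K, ∀ x' ∈ K,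
      dist t t' < δ → dist x x' < δ → dist (F t x) (F t' x') < ε)
    {ε : ℝ} (hε : 0 < ε) :
    ∃ δ > 0, ∀ m, ∀ c ∈ supported ℤ ℤ (smallLists m δ K), bd c = 0 →
      ∃ w ∈ supported ℤ ℤ (smallLists (m + 1) ε D), bd w = push (F 1) c - push (F 0) c := by
  obtain ⟨δ, hδ, h⟩ := hF ε hε
  refine ⟨δ, hδ, fun m c hc hbd => ?_⟩
  obtain ⟨N, hN⟩ := exists_nat_one_div_lt hδ
  set τ : ℕ → ℝ := fun j => j / (N + 1 : ℝ) with hτ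
  have hN0 : (0 : ℝ) < N + 1 := by positivity
  refine ⟨∑ j ∈ Finset.range (N + 1), prism (F (τ j)) (F (τ (j + 1))) c, ?_, ?_⟩
  · refine sum_mem fun j hj => map_mem_of_supported _ _ ?_ hc
    rintro l ⟨hl, hlK, hld⟩
    rw [prism_single]
    refine supported_mono ?_ (prismList_mem _ _ l)
    rintro l' ⟨hl', hy⟩
    have hj' : (j : ℝ) + 1 ≤ N + 1 := by
      have := Finset.mem_range.1 hj
      exact_mod_cast this
    have t0 : τ j ∈ Set.Icc (0 : ℝ) 1 :=
      ⟨by positivity, by rw [hτ, div_le_one hN0]; linarith⟩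
    have t1 : τ (j + 1) ∈ Set.Icc (0 : ℝ) 1 :=
      ⟨by positivity, by simp only [hτ]; rw [div_le_one hN0]; push_cast; linarith⟩
    have hd : dist (τ j) (τ (j + 1)) < δ := by
      have : τ j - τ (j + 1) = -(1 / (N + 1 : ℝ)) := by simp only [hτ]; push_cast; ring
      rw [Real.dist_eq, this, abs_neg, abs_of_pos (by positivity)]
      exact hN
    have hd' : dist (τ (j + 1)) (τ j) < δ := by rwa [dist_comm]
    refine ⟨by rw [hl', hl], fun y hyl => ?_, fun y hyl y' hyl' => ?_⟩
    · obtain ⟨v, hv, rfl | rfl⟩ := hy y hyl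
      · exact hD _ t0 _ (hlK v hv)
      · exact hD _ t1 _ (hlK v hv)
    · obtain ⟨v, hv, rfl | rfl⟩ := hy y hyl <;> obtain ⟨v', hv', rfl | rfl⟩ := hy y' hyl' <;>
        refine h _ (by assumption) _ (by assumption) _ (hlK v hv) _ (hlK v' hv') ?_
          (hld v hv v' hv') <;> first | assumption | simpa using hδ
  · have hstep : ∀ j, bd (prism (F (τ j)) (F (τ (j + 1))) c) =
        push (F (τ (j + 1))) c - push (F (τ j)) c := fun j => by
      simpa [hbd] using bd_prism (F (τ j)) (F (τ (j + 1))) c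
    have e1 : τ (N + 1) = 1 := by simp only [hτ]; push_cast; exact div_self hN0.ne'
    have e0 : τ 0 = 0 := by simp [hτ]
    rw [map_sum, Finset.sum_congr rfl fun j _ => hstep j,
      Finset.sum_range_sub (fun j => push (F (τ j)) c), e1, e0]


lemma exists_uniform_delta [PseudoMetricSpace X] [PseudoMetricSpace Y] (F : ℝ → X → Y)
    {K : Set X} (hK : IsCompact K)
    (hF : ContinuousOn (fun p : ℝ × X => F p.1 p.2) (Set.Icc (0 : ℝ) 1 ×ˢ K)) :
    ∀ ε > 0, ∃ δ > 0, ∀ t ∈ Set.Icc (0 : ℝ) 1, ∀ t' ∈ Set.Icc (0 : ℝ) 1, ∀ x ∈ K, ∀ x' ∈ K,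
      dist t t' < δ → dist x x' < δ → dist (F t x) (F t' x') < ε := by
  intro ε hε
  obtain ⟨δ, hδ, h⟩ := Metric.uniformContinuousOn_iff.1
    ((isCompact_Icc.prod hK).uniformContinuousOn_of_continuous hF) ε hε
  refine ⟨δ, hδ, fun t ht t' ht' x hx x' hx' h1 h2 => ?_⟩
  exact h (t, x) ⟨ht, hx⟩ (t', x') ⟨ht', hx'⟩ (max_lt h1 h2)

/-! ### Cycles on the boundary of the cross-polytope -/

/-- The boundary of the `m`-dimensional cross-polytope, inside `ℝ ^ N`. -/
def crossBoundary (N m : ℕ) : Set (EuclideanSpace ℝ (Fin N)) :=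
  {x | ∑ i, |x i| = 1 ∧ ∀ i : Fin N, m ≤ i → x i = 0}

lemma isCompact_crossBoundary (N m : ℕ) : IsCompact (crossBoundary N m) := by
  refine (isCompact_closedBall (0 : EuclideanSpace ℝ (Fin N)) 1).of_isClosed_subset ?_ ?_
  · refine IsClosed.inter (isClosed_eq (by fun_prop) (by fun_prop)) ?_
    have : {x : EuclideanSpace ℝ (Fin N) | ∀ i : Fin N, m ≤ i → x i = 0} =
        ⋂ i : Fin N, ⋂ _ : m ≤ i, {x | x i = 0} := by ext; simp
    change IsClosed {x : EuclideanSpace ℝ (Fin N) | ∀ i : Fin N, m ≤ i → x i = 0}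
    rw [this]
    exact isClosed_iInter fun i => isClosed_iInter fun _ =>
      isClosed_eq (by fun_prop) (by fun_prop)
  · rintro x ⟨hx, -⟩
    have h1 : ‖x‖ ^ 2 ≤ 1 := by
      rw [EuclideanSpace.real_norm_sq_eq, ← hx]
      refine Finset.sum_le_sum fun i _ => ?_
      have : |x i| ≤ 1 := hx ▸ Finset.single_le_sum (f := fun i => |x i|)
        (fun _ _ => abs_nonneg _) (Finset.mem_univ i)
      rw [← sq_abs]
      nlinarith [abs_nonneg (x i)]
    simpa using (sq_le_one_iff₀ (norm_nonneg x)).1 h1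

lemma neg_mem_crossBoundary {N m : ℕ} {x : EuclideanSpace ℝ (Fin N)}
    (hx : x ∈ crossBoundary N m) : -x ∈ crossBoundary N m :=
  ⟨by simpa using hx.1, fun i hi => by simpa using hx.2 i hi⟩

lemma ne_zero_of_mem_crossBoundary {N m : ℕ} {x : EuclideanSpace ℝ (Fin N)}
    (hx : x ∈ crossBoundary N m) : x ≠ 0 := by
  rintro rfl
  simpa using hx.1

lemma segment_mem_crossBoundary {N m : ℕ} (hm : m < N) {x : EuclideanSpace ℝ (Fin N)}
    (hx : x ∈ crossBoundary N m) {t : ℝ} (ht : t ∈ Set.Icc (0 : ℝ) 1) :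
    (1 - t) • x + t • EuclideanSpace.single (⟨m, hm⟩ : Fin N) (1 : ℝ) ∈
      crossBoundary N (m + 1) := by
  have hxm : x ⟨m, hm⟩ = 0 := hx.2 _ le_rfl
  refine ⟨?_, fun i hi => ?_⟩
  · have : ∀ i, |((1 - t) • x + t • EuclideanSpace.single (⟨m, hm⟩ : Fin N) (1 : ℝ)) i| =
        (1 - t) * |x i| + if i = ⟨m, hm⟩ then t else 0 := by
      intro i
      by_cases h : i = ⟨m, hm⟩
      · subst h
        simp [hxm, abs_of_nonneg ht.1]
      · simp [h, abs_mul, abs_of_nonneg (sub_nonneg.2 ht.2)]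
    simp only [this, Finset.sum_add_distrib, ← Finset.mul_sum, hx.1]
    simp
  · have : i ≠ ⟨m, hm⟩ := by rintro rfl; simp at hi
    simp [hx.2 i (by omega), this]

/-- Arbitrarily fine antipodally symmetric cycles on which every `cupSign` cochain of a sequence
of antipodal sign functions is odd. -/
lemma exists_odd_cycle (N m : ℕ) (hm : m ≤ N) : ∀ ε > 0,
    ∃ z ∈ supported ℤ ℤ (smallLists m ε (crossBoundary N m)),
      bd z = 0 ∧ push Neg.neg z = (-1 : ℤ) ^ m • z ∧
      ∀ S : ℕ → EuclideanSpace ℝ (Fin N) → ℤ,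
        (∀ i, ∀ x ≠ 0, S i (-x) = 1 - S i x) → Odd (eval (cupSign S) z) := by
  induction m with
  | zero =>
    intro ε hε
    exact ⟨single [] 1, single_mem ⟨by simp, by simp, by simp⟩, by simp [bdList], by simp,
      fun S _ => by simp [cupSign]⟩
  | succ m ih =>
    intro ε hε
    set e : EuclideanSpace ℝ (Fin N) := EuclideanSpace.single (⟨m, hm⟩ : Fin N) (1 : ℝ) with he
    have hD : ∀ t ∈ Set.Icc (0 : ℝ) 1, ∀ x ∈ crossBoundary N m,
        (1 - t) • x + t • e ∈ crossBoundary N (m + 1) :=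
      fun t ht x hx => segment_mem_crossBoundary hm hx ht
    have heD : e ∈ crossBoundary N (m + 1) := by
      refine ⟨?_, fun i hi => ?_⟩
      · have : ∀ i, |e i| = if i = ⟨m, hm⟩ then 1 else 0 := by
          intro i
          by_cases h : i = ⟨m, hm⟩ <;> simp [he, h]
        simp [this]
      · have : i ≠ ⟨m, hm⟩ := by rintro rfl; simp at hi
        simp [he, this]
    obtain ⟨δ, hδ, hδw⟩ := exists_homotopy_chain (fun t x => (1 - t) • x + t • e) hD
      (exists_uniform_delta _ (isCompact_crossBoundary N m) (by fun_prop)) hε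
    obtain ⟨z, hz, hbz, hAz, hodd⟩ := ih (by omega) δ hδ
    obtain ⟨w, hw, hbw⟩ := hδw m z hz hbz
    simp only [sub_self, zero_smul, one_smul, zero_add, sub_zero, add_zero, push_id] at hbw
    set h := cone e (push (fun _ => e) z) - w with hh
    have hhm : h ∈ supported ℤ ℤ (smallLists (m + 1) ε (crossBoundary N (m + 1))) := by
      refine sub_mem (cone_mem e (P := {l | l.length = m ∧ ∀ y ∈ l, y = e}) ?_
        (push_mem _ ?_ hz)) hw
      · rintro l ⟨hl, hy⟩
        have hy' : ∀ y ∈ e :: l, y = e := by simpa using hy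
        refine ⟨by simp [hl], fun v hv => hy' v hv ▸ heD, fun u hu v hv => ?_⟩
        rw [hy' u hu, hy' v hv, dist_self]
        exact hε
      · rintro l ⟨hl, -⟩
        exact ⟨by simp [hl], by simp⟩
    have hbh : bd h = z := by
      rw [hh, map_sub, bd_cone, bd_push, hbz, hbw]
      simp
    refine ⟨h + (-1 : ℤ) ^ (m + 1) • push Neg.neg h, add_mem hhm (Submodule.smul_mem _ _
      (push_mem _ ?_ hhm)), ?_, ?_, ?_⟩
    · rintro l ⟨hl, hK, hd⟩
      refine ⟨by simp [hl], ?_, ?_⟩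
      · simp only [List.mem_map, forall_exists_index, and_imp, forall_apply_eq_imp_iff₂]
        exact fun v hv => neg_mem_crossBoundary (hK v hv)
      · simp only [List.mem_map, forall_exists_index, and_imp, forall_apply_eq_imp_iff₂,
          dist_neg_neg]
        exact hd
    · rw [map_add, map_smul, bd_push, hbh, hAz, smul_smul, ← pow_add,
        show m + 1 + m = 2 * m + 1 by ring, pow_succ, pow_mul]
      simp
    · have : push Neg.neg (push Neg.neg h) = h := by
        rw [push_push]
        have : (Neg.neg ∘ Neg.neg : EuclideanSpace ℝ (Fin N) → _) = fun x => x := by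
          ext; simp
        rw [this, push_id]
      rw [map_add, map_smul, this, smul_add, smul_smul, ← mul_pow]
      simp [add_comm]
    · intro S hS
      have hhK : h ∈ supported ℤ ℤ
          {l | l.length = m + 1 ∧ ∀ u ∈ l, u ∈ crossBoundary N (m + 1)} := by
        refine supported_mono ?_ hhm
        rintro l ⟨hl, hK, -⟩
        exact ⟨hl, hK⟩
      have hneg := cupSign_neg S (K := crossBoundary N (m + 1))
        (fun i u hu => hS i u (ne_zero_of_mem_crossBoundary hu)) hhK
      rw [map_add, map_smul, hneg, ← cupSign_bd, hbh, smul_eq_mul, ← mul_assoc, ← pow_add,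
        show m + 1 + m = 2 * m + 1 by ring, pow_succ, pow_mul]
      have ho := hodd (fun i => S (i + 1)) fun i => hS (i + 1)
      obtain ⟨k, hk⟩ := ho
      exact ⟨eval (cupSign S) h - k - 1, by rw [hk]; ring⟩

/-! ### Sign functions on the sphere -/

lemma exists_antipodal_sign (E : Type*) [AddCommGroup E] [Module ℝ E] :
    ∃ T : E → ℤ, ∀ x ≠ 0, T (-x) = 1 - T x := by
  classical
  refine ⟨fun x => if WellOrderingRel x (-x) then 1 else 0, fun x hx => ?_⟩
  have hne : x ≠ -x := fun h => by
    have h2 : (2 : ℝ) • x = 0 := by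
      rw [two_smul]
      nth_rewrite 2 [h]
      exact add_neg_cancel x
    exact hx ((smul_eq_zero.1 h2).resolve_left two_ne_zero)
  rcases trichotomous_of WellOrderingRel x (-x) with h | h | h
  · simp [h, asymm_of WellOrderingRel h]
  · exact absurd h hne
  · simp [h, asymm_of WellOrderingRel h]

/-- Antipodal functions refining the signs of the coordinates. -/
lemma exists_coordinate_signs (N : ℕ) :
    ∃ S : ℕ → EuclideanSpace ℝ (Fin N) → ℤ, (∀ i, ∀ x ≠ 0, S i (-x) = 1 - S i x) ∧
      ∀ i : Fin N, ∀ x, (0 < x i → S i x = 1) ∧ (x i < 0 → S i x = 0) := by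
  classical
  obtain ⟨T, hT⟩ := exists_antipodal_sign (EuclideanSpace ℝ (Fin N))
  refine ⟨fun i x => if h : i < N then
    if 0 < x ⟨i, h⟩ then 1 else if x ⟨i, h⟩ < 0 then 0 else T x else T x, ?_, ?_⟩
  · intro i x hx
    by_cases h : i < N
    · rcases lt_trichotomy (x ⟨i, h⟩) 0 with h0 | h0 | h0
      · simp [h, h0, h0.not_gt]
      · simp [h, h0, hT x hx]
      · simp [h, h0, h0.not_gt]
    · simp [h, hT x hx]
  · intro i x
    refine ⟨fun h => by simp [h], fun h => by simp [h, h.not_gt]⟩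

lemma exists_large_coordinate {n : ℕ} {x : EuclideanSpace ℝ (Fin (n + 1))} (hx : ‖x‖ = 1) :
    ∃ i, 1 / (n + 1 : ℝ) ≤ |x i| := by
  by_contra! h
  have h1 := EuclideanSpace.real_norm_sq_eq x
  have hn : (0 : ℝ) < n + 1 := by positivity
  have h2 : ∑ i, x i ^ 2 < ∑ _i : Fin (n + 1), 1 / (n + 1 : ℝ) := by
    refine Finset.sum_lt_sum_of_nonempty Finset.univ_nonempty fun i _ => ?_
    have : 1 / (n + 1 : ℝ) ≤ 1 := by
      rw [div_le_one hn]
      linarith [(Nat.cast_nonneg n : (0 : ℝ) ≤ n)]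
    rw [← sq_abs]
    nlinarith [h i, abs_nonneg (x i)]
  rw [← h1, hx] at h2
  simp [hn.ne'] at h2

lemma cupDiff_eq_zero_of_small {n : ℕ} {S : ℕ → EuclideanSpace ℝ (Fin (n + 1)) → ℤ}
    (hS : ∀ i : Fin (n + 1), ∀ x, (0 < x i → S i x = 1) ∧ (x i < 0 → S i x = 0))
    {l : List (EuclideanSpace ℝ (Fin (n + 1)))}
    (hl : l ∈ smallLists (n + 2) (1 / (n + 1 : ℝ)) (Metric.sphere 0 1)) : cupDiff S l = 0 := by
  obtain ⟨hlen, hK, hd⟩ := hl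
  cases l with
  | nil => rfl
  | cons v t =>
    obtain ⟨i, hi⟩ := exists_large_coordinate (by simpa using hK v (by simp))
    have hlt : ∀ u ∈ v :: t, |v i - u i| < |v i| := fun u hu => by
      have h1 : |v i - u i| ≤ dist v u := by
        simpa [dist_eq_norm] using PiLp.norm_apply_le (v - u) i
      linarith [hd v (by simp) u hu]
    have hlen' : (i : ℕ) < t.length := by
      have := i.2
      simp at hlen
      omega
    rcases lt_or_ge (v i) 0 with h0 | h0
    · refine diffProd_eq_zero S v t i hlen' 0 fun u hu => (hS i u).2 ?_
      have := hlt u hu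
      rw [abs_of_neg h0, abs_lt] at this
      linarith
    · refine diffProd_eq_zero S v t i hlen' 1 fun u hu => (hS i u).1 ?_
      have := hlt u hu
      rw [abs_of_nonneg h0, abs_lt] at this
      linarith

end ListChain

open ListChain in
/-- For even `n ≥ 2`, an odd continuous self-map `g` of the sphere `S^n` is not homotopic to
the map `x ↦ -g(x)`. -/
theorem odd_not_homotopic_neg (n : ℕ) (hn : 2 ≤ n) (heven : Even n)
    (g : C(Metric.sphere (0 : EuclideanSpace ℝ (Fin (n + 1))) 1,
           Metric.sphere (0 : EuclideanSpace ℝ (Fin (n + 1))) 1))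
    (hg : ∀ x, g (-x) = -g x) :
    ∀ g' : C(Metric.sphere (0 : EuclideanSpace ℝ (Fin (n + 1))) 1,
             Metric.sphere (0 : EuclideanSpace ℝ (Fin (n + 1))) 1),
      (∀ x, g' x = -g x) → ¬ g.Homotopic g' := by
  rintro g' hg' ⟨H⟩
  classical
  let p : Metric.sphere (0 : EuclideanSpace ℝ (Fin (n + 1))) 1 :=
    ⟨EuclideanSpace.single 0 1, by simp⟩
  let ν : EuclideanSpace ℝ (Fin (n + 1)) → Metric.sphere (0 : EuclideanSpace ℝ (Fin (n + 1))) 1 :=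
    fun x => if h : x = 0 then p else ⟨‖x‖⁻¹ • x, by simp [norm_smul, h]⟩
  have hν : ∀ x ≠ 0, (ν x : EuclideanSpace ℝ (Fin (n + 1))) = ‖x‖⁻¹ • x :=
    fun x hx => by simp [ν, hx]
  have hν_neg : ∀ x ≠ 0, ν (-x) = -ν x := fun x hx => by
    apply Subtype.ext
    rw [coe_neg_sphere, hν x hx, hν (-x) (by simpa using hx)]
    simp
  set K := crossBoundary (n + 1) (n + 1)
  have hK0 : ∀ x ∈ K, x ≠ 0 := fun x hx => ne_zero_of_mem_crossBoundary hx
  have hν_cont : ContinuousOn ν K := by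
    rw [Topology.IsInducing.subtypeVal.continuousOn_iff]
    refine ContinuousOn.congr (f := fun x : EuclideanSpace ℝ (Fin (n + 1)) => ‖x‖⁻¹ • x) ?_
      fun x hx => hν x (hK0 x hx)
    exact ContinuousOn.smul (continuous_norm.continuousOn.inv₀ fun x hx => by
      exact norm_ne_zero_iff.2 (hK0 x hx)) continuousOn_id
  let F : ℝ → EuclideanSpace ℝ (Fin (n + 1)) → EuclideanSpace ℝ (Fin (n + 1)) :=
    fun t x => H (Set.projIcc 0 1 zero_le_one t, ν x)
  have hF : ContinuousOn (fun q : ℝ × EuclideanSpace ℝ (Fin (n + 1)) => F q.1 q.2)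
      (Set.Icc (0 : ℝ) 1 ×ˢ K) := by
    refine continuous_subtype_val.comp_continuousOn (H.continuous.comp_continuousOn ?_)
    refine ContinuousOn.prodMk (continuous_projIcc.comp continuous_fst).continuousOn ?_
    exact hν_cont.comp continuousOn_snd fun q hq => hq.2
  have hF0 : F 0 = fun x => (g (ν x) : EuclideanSpace ℝ (Fin (n + 1))) := by
    funext x
    simp only [F, Set.projIcc_left]
    exact congrArg Subtype.val (H.apply_zero _)
  have hF1 : F 1 = Neg.neg ∘ F 0 := by
    funext x
    rw [hF0]
    simp only [F, Set.projIcc_right, Function.comp]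
    refine (congrArg Subtype.val (H.apply_one _)).trans ?_
    rw [hg', coe_neg_sphere]
  have hFS : ∀ t x, F t x ∈ Metric.sphere (0 : EuclideanSpace ℝ (Fin (n + 1))) 1 :=
    fun t x => Subtype.coe_prop _
  have hFne : ∀ t x, F t x ≠ 0 := fun t x h => by simpa [h] using hFS t x
  have hFneg : ∀ x ≠ 0, F 0 (-x) = -F 0 x := fun x hx => by
    simp only [hF0, hν_neg x hx, hg, coe_neg_sphere]
  obtain ⟨S, hS, hSsign⟩ := exists_coordinate_signs (n + 1)
  obtain ⟨δ, hδ, hδw⟩ := exists_homotopy_chain F (D := Metric.sphere 0 1)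
    (fun t _ x _ => hFS t x)
    (exists_uniform_delta _ (isCompact_crossBoundary (n + 1) (n + 1)) hF)
    (ε := 1 / (n + 1 : ℝ)) (by positivity)
  obtain ⟨z, hz, hbz, -, hodd⟩ := exists_odd_cycle (n + 1) (n + 1) le_rfl δ hδ
  obtain ⟨w, hw, hbw⟩ := hδw (n + 1) z hz hbz
  have hw0 : eval (cupDiff S) w = 0 :=
    eq_of_supported (eval (cupDiff S)) 0
      (fun l hl => by simpa using cupDiff_eq_zero_of_small hSsign hl) hw
  set c := push (F 0) z with hc
  have hinv : eval (cupSign S) (push Neg.neg c) = eval (cupSign S) c := by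
    rw [← cupSign_bd, hbw, map_sub, sub_eq_zero, hF1, ← push_push] at hw0
    exact hw0
  have hneg : eval (cupSign S) (push Neg.neg c) = -eval (cupSign S) c := by
    rw [cupSign_neg S (K := Metric.sphere 0 1) (m := n), ← cupSign_bd, hc, bd_push, hbz,
      heven.neg_one_pow]
    · simp
    · exact fun i u hu => hS i u fun h => by simp [h] at hu
    · refine push_mem _ ?_ hz
      rintro l ⟨hl, -⟩
      refine ⟨by simp [hl], ?_⟩
      simp only [List.mem_map, forall_exists_index, and_imp, forall_apply_eq_imp_iff₂]
      exact fun x _ => hFS 0 x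
  have hodd' : Odd (eval (cupSign S) c) := by
    rw [hc, cupSign_push]
    exact hodd _ fun i x hx => by rw [hFneg x hx, hS i _ (hFne 0 x)]
  obtain ⟨k, hk⟩ := hodd'
  omega
end
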